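/- Let V₃ be the 4-dimensional space of homogeneous cubic polynomials in two variables over ℂ with the Sym³-action of GL₂(ℂ), and let ⋀²V₃ carry the induced action g·(P ∧ Q) = (g·P) ∧ (g·Q). Then there is an isomorphism of GL₂(ℂ)-representations ⋀²(Sym³) ≅ (Sym⁴ ⊗ det) ⊕ det³, i.e., a ℂ-linear isomorphism Φ : ⋀²V₃ → V₄ ⊕ ℂ such that Φ(g·ω) = ((det g)·(g·Q), (det g)³·c) whenever Φ(ω) = (Q, c), for all g ∈ GL₂(ℂ) and ω ∈ ⋀²V₃. -/

import Mathlib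

open scoped MatrixGroups

/-- The action of a `2×2` matrix `g` on two-variable polynomials by the substitution
`(g·P)(x) = P(gᵀ x)`, i.e. `Xᵢ ↦ ∑ⱼ g ⱼ ᵢ Xⱼ`. -/
noncomputable def matPolyAct (g : Matrix (Fin 2) (Fin 2) ℂ) (P : MvPolynomial (Fin 2) ℂ) :
    MvPolynomial (Fin 2) ℂ :=
  MvPolynomial.aeval (fun i => ∑ j, MvPolynomial.C (g j i) * MvPolynomial.X j) P

/-- `Vₖ`: homogeneous polynomials of degree `k` in two variables over `ℂ`. -/
noncomputable def homPoly (k : ℕ) : Submodule ℂ (MvPolynomial (Fin 2) ℂ) :=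
  MvPolynomial.homogeneousSubmodule (Fin 2) ℂ k

/-- The wedge `p ∧ q` of two elements, as an element of the second exterior power
`⋀²M ⊆ ⋀M`. -/
noncomputable def wedge2 {M : Type*} [AddCommGroup M] [Module ℂ M] (p q : M) :
    ↥(⋀[ℂ]^2 M) :=
  ⟨ExteriorAlgebra.ιMulti ℂ 2 ![p, q],
    ExteriorAlgebra.ιMulti_range ℂ 2 (Set.mem_range_self _)⟩

/-- The binary form monomial with coefficient. -/
noncomputable def bmon (a : ℂ) (p q : ℕ) : MvPolynomial (Fin 2) ℂ :=
  MvPolynomial.C a * MvPolynomial.X 0 ^ p * MvPolynomial.X 1 ^ q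

/-- The exponent vector `(p, q)`. -/
noncomputable def bexp (p q : ℕ) : Fin 2 →₀ ℕ := Finsupp.single 0 p + Finsupp.single 1 q

lemma bmon_eq (a : ℂ) (p q : ℕ) : bmon a p q = MvPolynomial.monomial (bexp p q) a := by
  rw [bmon, bexp, MvPolynomial.monomial_add_single, MvPolynomial.C_mul_X_pow_eq_monomial]

lemma bexp_inj (p q r s : ℕ) : bexp p q = bexp r s ↔ p = r ∧ q = s := by
  constructor
  · intro h
    have h0 := DFunLike.congr_fun h 0
    have h1 := DFunLike.congr_fun h 1
    simp [bexp] at h0 h1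
    exact ⟨h0, h1⟩
  · rintro ⟨rfl, rfl⟩; rfl

lemma coeff_bmon (a : ℂ) (p q r s : ℕ) :
    MvPolynomial.coeff (bexp r s) (bmon a p q) = if p = r ∧ q = s then a else 0 := by
  rw [bmon_eq, MvPolynomial.coeff_monomial]
  simp only [bexp_inj]

lemma bexp_surj (d : Fin 2 →₀ ℕ) : d = bexp (d 0) (d 1) := by
  ext i; fin_cases i <;> simp [bexp]

lemma bmon_mem (a : ℂ) (p q k : ℕ) (h : p + q = k) : bmon a p q ∈ homPoly k := by
  subst h
  rw [homPoly, MvPolynomial.mem_homogeneousSubmodule, bmon, mul_assoc]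
  exact ((MvPolynomial.isHomogeneous_X_pow _ _).mul (MvPolynomial.isHomogeneous_X_pow _ _)).C_mul _

lemma homPoly_coeff {k : ℕ} {P : MvPolynomial (Fin 2) ℂ} (hP : P ∈ homPoly k) (p q : ℕ)
    (h : p + q ≠ k) : P.coeff (bexp p q) = 0 := by
  rw [homPoly, MvPolynomial.mem_homogeneousSubmodule] at hP
  apply hP.coeff_eq_zero
  simpa [bexp, Finsupp.degree_eq_sum] using h

lemma homPoly_expand {k : ℕ} {P : MvPolynomial (Fin 2) ℂ} (hP : P ∈ homPoly k) :
    P = ∑ i : Fin (k + 1), bmon (P.coeff (bexp (k - i) i)) (k - i) i := by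
  ext d
  rw [bexp_surj d, MvPolynomial.coeff_sum]
  generalize d 0 = p
  generalize d 1 = q
  simp only [coeff_bmon]
  by_cases h : p + q = k
  · subst h
    rw [Finset.sum_eq_single (⟨q, by omega⟩ : Fin (p + q + 1))]
    · simp
    · intro b _ hb
      rw [if_neg]
      rintro ⟨_, h2⟩
      exact hb (Fin.ext h2)
    · simp
  · rw [homPoly_coeff hP _ _ h, Finset.sum_eq_zero]
    intro i _
    rw [if_neg]
    have := i.2
    omega

/-- Coordinates on binary forms. -/
noncomputable def homEquiv (k : ℕ) : ↥(homPoly k) ≃ₗ[ℂ] (Fin (k + 1) → ℂ) where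
  toFun P i := P.1.coeff (bexp (k - i) i)
  map_add' P Q := by ext i; simp
  map_smul' a P := by ext i; simp
  invFun v := ⟨∑ i : Fin (k + 1), bmon (v i) (k - i) i,
    Submodule.sum_mem _ fun i _ => bmon_mem _ _ _ _ (by have := i.2; omega)⟩
  left_inv P := Subtype.ext (homPoly_expand P.2).symm
  right_inv v := by
    ext i
    simp only [MvPolynomial.coeff_sum, coeff_bmon]
    rw [Finset.sum_eq_single i]
    · simp
    · intro b _ hb
      rw [if_neg]
      rintro ⟨_, h2⟩
      exact hb (Fin.ext h2)
    · simp

/-- Binary cubic with given coefficients. -/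
noncomputable def cub (a b c d : ℂ) : MvPolynomial (Fin 2) ℂ :=
  bmon a 3 0 + bmon b 2 1 + bmon c 1 2 + bmon d 0 3

lemma cub_mem (a b c d : ℂ) : cub a b c d ∈ homPoly 3 :=
  add_mem (add_mem (add_mem (bmon_mem _ _ _ _ rfl) (bmon_mem _ _ _ _ rfl))
    (bmon_mem _ _ _ _ rfl)) (bmon_mem _ _ _ _ rfl)

lemma exists_cub {P : MvPolynomial (Fin 2) ℂ} (hP : P ∈ homPoly 3) :
    ∃ a b c d, P = cub a b c d := by
  have h := homPoly_expand hP
  rw [Fin.sum_univ_four] at h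
  exact ⟨_, _, _, _, h⟩

/-- The Jacobian (first transvectant). -/
noncomputable def jac (P Q : MvPolynomial (Fin 2) ℂ) : MvPolynomial (Fin 2) ℂ :=
  MvPolynomial.pderiv 0 P * MvPolynomial.pderiv 1 Q -
    MvPolynomial.pderiv 1 P * MvPolynomial.pderiv 0 Q

/-- The third transvectant of two cubics, up to scaling. -/
noncomputable def tra (P Q : MvPolynomial (Fin 2) ℂ) : ℂ :=
  3 * P.coeff (bexp 3 0) * Q.coeff (bexp 0 3) - P.coeff (bexp 2 1) * Q.coeff (bexp 1 2)
    + P.coeff (bexp 1 2) * Q.coeff (bexp 2 1) - 3 * P.coeff (bexp 0 3) * Q.coeff (bexp 3 0)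

lemma tra_cub (a b c d a' b' c' d' : ℂ) :
    tra (cub a b c d) (cub a' b' c' d') = 3 * a * d' - b * c' + c * b' - 3 * d * a' := by
  simp [tra, cub, coeff_bmon]

lemma jac_mem {P Q : MvPolynomial (Fin 2) ℂ} (hP : P ∈ homPoly 3) (hQ : Q ∈ homPoly 3) :
    jac P Q ∈ homPoly 4 := by
  rw [homPoly, MvPolynomial.mem_homogeneousSubmodule] at *
  exact (hP.pderiv.mul hQ.pderiv).sub (hP.pderiv.mul hQ.pderiv)

lemma C_nums : (MvPolynomial.C (2 : ℂ) : MvPolynomial (Fin 2) ℂ) = 2 ∧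
    (MvPolynomial.C (3 : ℂ) : MvPolynomial (Fin 2) ℂ) = 3 ∧
    (MvPolynomial.C (6 : ℂ) : MvPolynomial (Fin 2) ℂ) = 6 ∧
    (MvPolynomial.C (9 : ℂ) : MvPolynomial (Fin 2) ℂ) = 9 :=
  ⟨map_ofNat _ 2, map_ofNat _ 3, map_ofNat _ 6, map_ofNat _ 9⟩

lemma act_add (g : Matrix (Fin 2) (Fin 2) ℂ) (P Q : MvPolynomial (Fin 2) ℂ) :
    matPolyAct g (P + Q) = matPolyAct g P + matPolyAct g Q := by
  simp [matPolyAct]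

lemma act_bmon (g : Matrix (Fin 2) (Fin 2) ℂ) (a : ℂ) (p q : ℕ) :
    matPolyAct g (bmon a p q) = MvPolynomial.C a *
      (MvPolynomial.C (g 0 0) * MvPolynomial.X 0 + MvPolynomial.C (g 1 0) * MvPolynomial.X 1) ^ p *
      (MvPolynomial.C (g 0 1) * MvPolynomial.X 0 + MvPolynomial.C (g 1 1) * MvPolynomial.X 1) ^ q := by
  simp [matPolyAct, bmon, Fin.sum_univ_two, MvPolynomial.algebraMap_eq]

lemma jac_cub (a b c d a' b' c' d' : ℂ) :
    jac (cub a b c d) (cub a' b' c' d') =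
      bmon (3 * (a * b' - b * a')) 4 0 + bmon (6 * (a * c' - c * a')) 3 1
      + bmon (9 * (a * d' - d * a') + 3 * (b * c' - c * b')) 2 2
      + bmon (6 * (b * d' - d * b')) 1 3 + bmon (3 * (c * d' - d * c')) 0 4 := by
  simp [jac, cub, bmon, MvPolynomial.pderiv_X]
  simp only [C_nums]
  ring

lemma act_cub (g : Matrix (Fin 2) (Fin 2) ℂ) (a b c d : ℂ) :
    matPolyAct g (cub a b c d) = cub
      (a * g 0 0 ^ 3 + b * g 0 0 ^ 2 * g 0 1 + c * g 0 0 * g 0 1 ^ 2 + d * g 0 1 ^ 3)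
      (3 * a * g 0 0 ^ 2 * g 1 0 + b * (2 * g 0 0 * g 1 0 * g 0 1 + g 0 0 ^ 2 * g 1 1)
        + c * (g 1 0 * g 0 1 ^ 2 + 2 * g 0 0 * g 0 1 * g 1 1) + 3 * d * g 0 1 ^ 2 * g 1 1)
      (3 * a * g 0 0 * g 1 0 ^ 2 + b * (2 * g 0 0 * g 1 0 * g 1 1 + g 1 0 ^ 2 * g 0 1)
        + c * (g 0 0 * g 1 1 ^ 2 + 2 * g 1 0 * g 0 1 * g 1 1) + 3 * d * g 0 1 * g 1 1 ^ 2)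
      (a * g 1 0 ^ 3 + b * g 1 0 ^ 2 * g 1 1 + c * g 1 0 * g 1 1 ^ 2 + d * g 1 1 ^ 3) := by
  simp only [cub, act_add, act_bmon]
  simp only [bmon, map_add, map_mul, map_pow, C_nums]
  ring

lemma jac_act (g : Matrix (Fin 2) (Fin 2) ℂ) {P Q : MvPolynomial (Fin 2) ℂ}
    (hP : P ∈ homPoly 3) (hQ : Q ∈ homPoly 3) :
    jac (matPolyAct g P) (matPolyAct g Q) = g.det • matPolyAct g (jac P Q) := by
  obtain ⟨a, b, c, d, rfl⟩ := exists_cub hP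
  obtain ⟨a', b', c', d', rfl⟩ := exists_cub hQ
  rw [act_cub, act_cub, jac_cub, jac_cub, Matrix.det_fin_two, MvPolynomial.smul_eq_C_mul]
  simp only [act_add, act_bmon]
  simp only [bmon, map_add, map_sub, map_mul, map_pow, C_nums]
  ring

lemma tra_act (g : Matrix (Fin 2) (Fin 2) ℂ) {P Q : MvPolynomial (Fin 2) ℂ}
    (hP : P ∈ homPoly 3) (hQ : Q ∈ homPoly 3) :
    tra (matPolyAct g P) (matPolyAct g Q) = g.det ^ 3 * tra P Q := by
  obtain ⟨a, b, c, d, rfl⟩ := exists_cub hP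
  obtain ⟨a', b', c', d', rfl⟩ := exists_cub hQ
  rw [act_cub, act_cub, tra_cub, tra_cub, Matrix.det_fin_two]
  ring

/-- The alternating map `(P, Q) ↦ (jac P Q, tra P Q)`. -/
noncomputable def altJT : ↥(homPoly 3) [⋀^Fin 2]→ₗ[ℂ] (↥(homPoly 4) × ℂ) where
  toFun v := (⟨jac (v 0) (v 1), jac_mem (v 0).2 (v 1).2⟩, tra (v 0) (v 1))
  map_update_add' v i x y := by
    fin_cases i <;> ext : 2 <;> simp [jac, tra, Function.update] <;> ring
  map_update_smul' v i a x := by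
    fin_cases i <;> ext : 2 <;> simp [jac, tra, Function.update, MvPolynomial.smul_eq_C_mul] <;> ring
  map_eq_zero_of_eq' v i j h hij := by
    have h01 : v 0 = v 1 := by
      fin_cases i <;> fin_cases j <;> simp_all
    ext : 2
    · simp [jac, h01]; ring
    · simp [tra, h01]; ring

/-- The induced linear map on the exterior square. -/
noncomputable def linJT : ↥(⋀[ℂ]^2 ↥(homPoly 3)) →ₗ[ℂ] (↥(homPoly 4) × ℂ) :=
  exteriorPower.alternatingMapLinearEquiv altJT

lemma linJT_wedge (P Q : ↥(homPoly 3)) :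
    linJT (wedge2 P Q) = (⟨jac P Q, jac_mem P.2 Q.2⟩, tra P Q) :=
  exteriorPower.alternatingMapLinearEquiv_apply_ιMulti altJT ![P, Q]

/-- Cubics as elements of the submodule. -/
noncomputable def cubS (a b c d : ℂ) : ↥(homPoly 3) := ⟨cub a b c d, cub_mem a b c d⟩

lemma linJT_surj : Function.Surjective linJT := by
  rintro ⟨⟨R, hR⟩, t⟩
  have hx := homPoly_expand hR
  rw [Fin.sum_univ_five] at hx
  simp at hx
  generalize R.coeff (bexp 4 0) = r0 at hx
  generalize R.coeff (bexp 3 1) = r1 at hx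
  generalize R.coeff (bexp 2 2) = r2 at hx
  generalize R.coeff (bexp 1 3) = r3 at hx
  generalize R.coeff (bexp 0 4) = r4 at hx
  refine ⟨wedge2 (cubS 1 0 0 0) (cubS 0 (r0 / 3) (r1 / 6) ((r2 + 3 * t) / 18))
    + wedge2 (cubS 0 1 0 0) (cubS 0 0 ((r2 - 3 * t) / 6) (r3 / 6))
    + wedge2 (cubS 0 0 1 0) (cubS 0 0 0 (r4 / 3)), ?_⟩
  rw [map_add, map_add, linJT_wedge, linJT_wedge, linJT_wedge]
  ext : 2
  · simp only [cubS, jac_cub, Prod.fst_add, Submodule.coe_add]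
    rw [hx]
    simp only [bmon_eq]
    ext d
    simp only [MvPolynomial.coeff_add, MvPolynomial.coeff_monomial]
    split_ifs <;> ring
  · simp only [cubS, tra_cub, Prod.snd_add]
    ring

lemma linJT_bij : Function.Bijective linJT := by
  have : Module.Finite ℂ ↥(homPoly 3) := Module.Finite.equiv (homEquiv 3).symm
  have : Module.Finite ℂ ↥(homPoly 4) := Module.Finite.equiv (homEquiv 4).symm
  have h : Module.finrank ℂ ↥(⋀[ℂ]^2 ↥(homPoly 3)) = Module.finrank ℂ (↥(homPoly 4) × ℂ) := by
    rw [exteriorPower.finrank_eq, Module.finrank_prod, (homEquiv 3).finrank_eq,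
      (homEquiv 4).finrank_eq]
    simp [Nat.choose]
  exact ⟨(LinearMap.injective_iff_surjective_of_finrank_eq_finrank h).2 linJT_surj, linJT_surj⟩

/-- `⋀²(Sym³) ≅ (Sym⁴ ⊗ det) ⊕ det³` as representations of `GL₂(ℂ)`:  there is a
`ℂ`-linear isomorphism `Φ : ⋀²V₃ → V₄ ⊕ ℂ` with
`Φ((g·P) ∧ (g·Q)) = ((det g) • (g·R), (det g)³ · c)` whenever `Φ(P ∧ Q) = (R, c)`. -/
theorem exterior_square_sym3_decomposition :
    ∃ Φ : ↥(⋀[ℂ]^2 ↥(homPoly 3)) ≃ₗ[ℂ] (↥(homPoly 4) × ℂ),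
      ∀ (g : GL (Fin 2) ℂ) (P Q : MvPolynomial (Fin 2) ℂ)
        (hP : P ∈ homPoly 3) (hQ : Q ∈ homPoly 3)
        (hP' : matPolyAct g P ∈ homPoly 3) (hQ' : matPolyAct g Q ∈ homPoly 3)
        (Rp : MvPolynomial (Fin 2) ℂ) (hR : Rp ∈ homPoly 4)
        (hR' : matPolyAct g Rp ∈ homPoly 4) (c : ℂ),
        Φ (wedge2 (⟨P, hP⟩ : ↥(homPoly 3)) ⟨Q, hQ⟩) = (⟨Rp, hR⟩, c) →
        Φ (wedge2 (⟨matPolyAct g P, hP'⟩ : ↥(homPoly 3)) ⟨matPolyAct g Q, hQ'⟩) =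
          (((g : Matrix (Fin 2) (Fin 2) ℂ).det) • (⟨matPolyAct g Rp, hR'⟩ : ↥(homPoly 4)),
            ((g : Matrix (Fin 2) (Fin 2) ℂ).det) ^ 3 * c) := by
  refine ⟨LinearEquiv.ofBijective linJT linJT_bij, ?_⟩
  intro g P Q hP hQ hP' hQ' Rp hR hR' c h
  rw [LinearEquiv.ofBijective_apply, linJT_wedge] at h ⊢
  obtain ⟨h1, h2⟩ := Prod.mk.inj h
  have h1 : jac P Q = Rp := congrArg Subtype.val h1
  have h2 : tra P Q = c := h2
  subst h1 h2
  refine Prod.ext (Subtype.ext ?_) ?_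
  · exact jac_act _ hP hQ
  · exact tra_act _ hP hQ
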